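/- arXiv:2403.12919 — 2 statements merged into one kernel-verified Lean document; each statement's English description precedes it below -/
import Mathlib

section
/- Let P,Q be positive integers with P ≥ Q+2 and let p,q ∈ (0,1) be real numbers such that Pp + Qq = 1 and (P−1)p ≤ Qq. Set P' = P−1, Q' = Q+1, p' = Pp/(P−1), and q' = Qq/(Q+1). Then p',q' ∈ (0,1), P'p' + Q'q' = 1, and d_{K_m}(R(p,P;q,Q)) < d_{K_m}(R(p',P';q',Q')) for every integer m with 2 ≤ m ≤ P+Q. -/
/-- The `K_m`-density of the two-part weighted graph `R(p,P;q,Q)`: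
`d_{K_m}(R(p,P;q,Q)) = m!·∑_{x+y=m} C(P,x) C(Q,y) p^x q^y (1/2)^{C(x,2)+C(y,2)}`. -/
noncomputable def dRpq (m P Q : ℕ) (p q : ℝ) : ℝ :=
  (m.factorial : ℝ) * ∑ x ∈ Finset.range (m + 1),
    (P.choose x : ℝ) * (Q.choose (m - x) : ℝ) * p ^ x * q ^ (m - x) *
      (1 / 2 : ℝ) ^ (x.choose 2 + (m - x).choose 2)

/-- Normalised binomial coefficient. -/
noncomputable def nF (n x : ℕ) : ℝ := (n.choose x : ℝ) / (n : ℝ) ^ x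

/-- The clique weight of `x` vertices inside one part. -/
noncomputable def cw (x : ℕ) : ℝ := (1 / 2 : ℝ) ^ (x.choose 2)

/-- Ratio of normalised binomial coefficients. -/
noncomputable def gR (n k : ℕ) : ℝ := (1 - (k : ℝ) / (n + 1)) * (((n : ℝ) + 1) / n) ^ k

lemma nF_nonneg (n x : ℕ) : 0 ≤ nF n x := by unfold nF; positivity

lemma nF_pos {n x : ℕ} (hn : 0 < n) (h : x ≤ n) : 0 < nF n x := by
  have := Nat.choose_pos h
  unfold nF; positivity

lemma cw_pos (x : ℕ) : 0 < cw x := by unfold cw; positivity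

lemma cw_succ (x : ℕ) : cw (x + 1) = cw x * (1 / 2) ^ x := by
  unfold cw
  rw [← pow_add, Nat.choose_succ_succ' x 1, Nat.choose_one_right, add_comm]

lemma gR_anti (n : ℕ) (hn : 0 < n) : Antitone (gR n) := by
  apply antitone_nat_of_succ_le
  intro k
  have hn' : (0 : ℝ) < n := by exact_mod_cast hn
  have : gR n k - gR n (k + 1) = (((n : ℝ) + 1) / n) ^ k * ((k : ℝ) / (n * (n + 1))) := by
    unfold gR
    rw [pow_succ]
    push_cast
    field_simp
    ring
  have h2 : 0 ≤ (((n : ℝ) + 1) / n) ^ k * ((k : ℝ) / (n * (n + 1))) := by positivity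
  linarith

lemma nF_gR (n k : ℕ) (hn : 0 < n) : nF n k = nF (n + 1) k * gR n k := by
  have hn' : (0 : ℝ) < n := by exact_mod_cast hn
  have key : (n.choose k : ℝ) * (n + 1) = ((n + 1).choose k : ℝ) * (n + 1 - k) := by
    rcases le_or_gt k (n + 1) with h | h
    · have := Nat.choose_mul_succ_eq n k
      have h3 : (((n.choose k) * (n + 1) : ℕ) : ℝ) = (((n + 1).choose k * (n + 1 - k) : ℕ) : ℝ) := by
        exact_mod_cast this
      rw [Nat.cast_mul, Nat.cast_mul, Nat.cast_sub h] at h3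
      push_cast at h3
      exact h3
    · rw [Nat.choose_eq_zero_of_lt h, Nat.choose_eq_zero_of_lt (by omega)]
      simp
  have key2 : (n.choose k : ℝ) = ((n + 1).choose k : ℝ) * (1 - k / (n + 1)) := by
    field_simp
    linarith
  unfold nF gR
  rw [key2]
  push_cast
  rw [div_pow]
  field_simp

lemma nF_succ (n x : ℕ) (hn : 0 < n) :
    nF n (x + 1) = nF n x * ((1 - (x : ℝ) / n) / (x + 1)) := by
  have hn' : (0 : ℝ) < n := by exact_mod_cast hn
  have key : (n.choose (x + 1) : ℝ) * (x + 1) = (n.choose x : ℝ) * (n - x) := by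
    rcases le_or_gt x n with h | h
    · have := Nat.choose_succ_right_eq n x
      have h3 : (((n.choose (x + 1)) * (x + 1) : ℕ) : ℝ) = ((n.choose x * (n - x) : ℕ) : ℝ) := by
        exact_mod_cast this
      rw [Nat.cast_mul, Nat.cast_mul, Nat.cast_sub h] at h3
      push_cast at h3
      exact h3
    · rw [Nat.choose_eq_zero_of_lt h, Nat.choose_eq_zero_of_lt (by omega)]
      simp
  have key2 : (n.choose (x + 1) : ℝ) = (n.choose x : ℝ) * (n - x) / (x + 1) := by
    field_simp
    linarith
  unfold nF
  rw [key2, pow_succ]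
  field_simp

lemma nF_cross (n Q : ℕ) (hQ : 0 < Q) (h : Q ≤ n) (y x : ℕ) (hxy : y ≤ x) :
    nF n y * nF Q x ≤ nF n x * nF Q y := by
  induction x, hxy using Nat.le_induction with
  | base => exact le_refl _
  | succ x hx ih =>
    have hQ' : (0 : ℝ) < Q := by exact_mod_cast hQ
    have hn' : (0 : ℝ) < n := by exact_mod_cast (lt_of_lt_of_le hQ h)
    have hQn : (Q : ℝ) ≤ n := by exact_mod_cast h
    rcases le_or_gt Q x with hc | hc
    · have : nF Q (x + 1) = 0 := by
        unfold nF; rw [Nat.choose_eq_zero_of_lt (by omega)]; simp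
      rw [this, mul_zero]
      exact mul_nonneg (nF_nonneg _ _) (nF_nonneg _ _)
    · rw [nF_succ n x (by omega), nF_succ Q x hQ]
      have hx' : (x : ℝ) ≤ Q := by exact_mod_cast hc.le
      have h1 : (1 - (x : ℝ) / Q) / (x + 1) ≤ (1 - (x : ℝ) / n) / (x + 1) := by
        gcongr
      have h0 : 0 ≤ (1 - (x : ℝ) / Q) / (x + 1) := by
        have : (x : ℝ) / Q ≤ 1 := by rw [div_le_one hQ']; exact hx'
        apply div_nonneg <;> [linarith; positivity]
      calc nF n y * (nF Q x * ((1 - (x : ℝ) / Q) / (x + 1)))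
          = (nF n y * nF Q x) * ((1 - (x : ℝ) / Q) / (x + 1)) := by ring
        _ ≤ (nF n x * nF Q y) * ((1 - (x : ℝ) / n) / (x + 1)) := by
            apply mul_le_mul ih h1 h0
            exact mul_nonneg (nF_nonneg _ _) (nF_nonneg _ _)
        _ = _ := by ring

open Finset in
lemma pair_nonneg (k : ℕ) (f : ℕ → ℕ → ℝ) (h : ∀ x y, y ≤ x → 0 ≤ f x y + f y x) :
    0 ≤ ∑ z ∈ antidiagonal k, f z.1 z.2 := by
  have h1 : ∑ z ∈ antidiagonal k, f z.2 z.1 = ∑ z ∈ antidiagonal k, f z.1 z.2 :=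
    Finset.Nat.sum_antidiagonal_swap (f := fun z => f z.1 z.2)
  have h2 : 0 ≤ ∑ z ∈ antidiagonal k, (f z.1 z.2 + f z.2 z.1) := by
    apply Finset.sum_nonneg
    intro z _
    rcases le_total z.2 z.1 with h' | h'
    · exact h _ _ h'
    · rw [add_comm]; exact h _ _ h'
  rw [Finset.sum_add_distrib, h1] at h2
  linarith

/-- The density without the factor `m!`, in terms of the total weights of the parts. -/
noncomputable def dG (P Q : ℕ) (a b : ℝ) (m : ℕ) : ℝ :=
  ∑ z ∈ Finset.HasAntidiagonal.antidiagonal m, nF P z.1 * nF Q z.2 * (a ^ z.1 * b ^ z.2) * (cw z.1 * cw z.2)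

lemma dRpq_eq (m P Q : ℕ) (hP : 0 < P) (hQ : 0 < Q) (p q : ℝ) :
    dRpq m P Q p q = m.factorial * dG P Q (P * p) (Q * q) m := by
  have hQ' : (0 : ℝ) < Q := by exact_mod_cast hQ
  have hP' : (0 : ℝ) < P := by exact_mod_cast hP
  unfold dRpq dG
  rw [Finset.Nat.sum_antidiagonal_eq_sum_range_succ
    (fun x y => nF P x * nF Q y * (((P : ℝ) * p) ^ x * ((Q : ℝ) * q) ^ y) * (cw x * cw y)) m]
  congr 1
  apply Finset.sum_congr rfl
  intro x _
  unfold nF cw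
  rw [pow_add, mul_pow, mul_pow]
  field_simp

/-- Balanced swap of the total weights (step C). -/
lemma stepC (n N : ℕ) (hN : 0 < N) (h : N ≤ n) (m : ℕ) :
    dG n N n (n + 1) m ≤ dG n N (n + 1) n m := by
  have := pair_nonneg m (fun x y => nF n x * nF N y * (((n : ℝ) + 1) ^ x * (n : ℝ) ^ y
    - (n : ℝ) ^ x * ((n : ℝ) + 1) ^ y) * (cw x * cw y)) ?_
  · rw [← sub_nonneg]
    unfold dG
    rw [← Finset.sum_sub_distrib]
    refine this.trans_eq ?_
    apply Finset.sum_congr rfl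
    intro z _
    ring
  · intro x y hxy
    have h1 := nF_cross n N hN h y x hxy
    have h2 : (n : ℝ) ^ x * ((n : ℝ) + 1) ^ y ≤ ((n : ℝ) + 1) ^ x * (n : ℝ) ^ y := by
      obtain ⟨d, rfl⟩ := Nat.exists_eq_add_of_le hxy
      rw [pow_add, pow_add]
      have : (n : ℝ) ^ d ≤ ((n : ℝ) + 1) ^ d := by gcongr; linarith
      calc (n : ℝ) ^ y * (n : ℝ) ^ d * ((n : ℝ) + 1) ^ y
          = ((n : ℝ) ^ y * ((n : ℝ) + 1) ^ y) * (n : ℝ) ^ d := by ring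
        _ ≤ ((n : ℝ) ^ y * ((n : ℝ) + 1) ^ y) * ((n : ℝ) + 1) ^ d := by gcongr
        _ = _ := by ring
    have h3 := mul_nonneg (mul_nonneg (sub_nonneg.2 h1) (sub_nonneg.2 h2))
      (mul_pos (cw_pos x) (cw_pos y)).le
    refine h3.trans_eq ?_
    ring

/-- Moving one vertex to the other part (step A). -/
lemma stepA (n Q : ℕ) (hQ : 0 < Q) (h : Q ≤ n) (k : ℕ) :
    ∑ z ∈ Finset.HasAntidiagonal.antidiagonal k, nF n z.1 * nF Q z.2 * (n : ℝ) ^ k * (cw (z.1 + 1) * cw z.2)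
    ≤ ∑ z ∈ Finset.HasAntidiagonal.antidiagonal k, nF n z.1 * nF Q z.2 * (n : ℝ) ^ k * (cw z.1 * cw (z.2 + 1)) := by
  have := pair_nonneg k (fun x y => nF n x * nF Q y * (n : ℝ) ^ k *
    ((1 / 2) ^ y - (1 / 2) ^ x) * (cw x * cw y)) ?_
  · rw [← sub_nonneg, ← Finset.sum_sub_distrib]
    refine this.trans_eq ?_
    apply Finset.sum_congr rfl
    intro z _
    rw [cw_succ, cw_succ]
    ring
  · intro x y hxy
    have h1 := nF_cross n Q hQ h y x hxy
    have h2 : (1 / 2 : ℝ) ^ x ≤ (1 / 2) ^ y :=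
      pow_le_pow_of_le_one (by norm_num) (by norm_num) hxy
    have h3 := mul_nonneg (mul_nonneg (mul_nonneg (sub_nonneg.2 h1) (sub_nonneg.2 h2))
      (mul_pos (cw_pos x) (cw_pos y)).le) (by positivity : (0 : ℝ) ≤ (n : ℝ) ^ k)
    refine h3.trans_eq ?_
    ring

/-- Bernoulli in homogeneous form. -/
lemma bern (s t : ℝ) (hs : 0 < s) (ht : 0 < t) (j : ℕ) :
    s ^ (j + 1) - (j + 1) * s ^ j * (s - t) ≤ t ^ (j + 1) := by
  have h := one_add_mul_le_pow (a := t / s - 1) (by have := div_pos ht hs; linarith) (j + 1)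
  have h2 := mul_le_mul_of_nonneg_left h (pow_pos hs (j + 1)).le
  have e1 : s ^ (j + 1) * (1 + (t / s - 1)) ^ (j + 1) = t ^ (j + 1) := by
    rw [← mul_pow]; congr 1; field_simp; ring
  rw [e1] at h2
  refine le_trans (le_of_eq ?_) h2
  push_cast
  rw [pow_succ]
  field_simp
  ring

lemma bern_strict (s t : ℝ) (hs : 0 < s) (ht : 0 < t) (hst : s ≠ t) (j : ℕ) :
    s ^ (j + 2) - (j + 2) * s ^ (j + 1) * (s - t) < t ^ (j + 2) := by
  have h := bern s t hs ht j
  have h1 := mul_le_mul_of_nonneg_left h ht.le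
  have h2 : 0 < (j + 1) * s ^ j * (s - t) ^ 2 := by
    have : 0 < (s - t) ^ 2 := by
      have := sub_ne_zero.2 hst
      positivity
    positivity
  have e : t ^ (j + 2) = t * t ^ (j + 1) := by ring
  rw [e]
  refine lt_of_lt_of_le ?_ h1
  have : t * (s ^ (j + 1) - (j + 1) * s ^ j * (s - t)) -
    (s ^ (j + 2) - (j + 2) * s ^ (j + 1) * (s - t)) = (j + 1) * s ^ j * (s - t) ^ 2 := by ring
  linarith

/-- Elementary symmetric function of one entry `1` and `Q` entries `s`. -/
noncomputable def eS (Q : ℕ) (s : ℝ) : ℕ → ℝ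
  | 0 => 1
  | y + 1 => (Q.choose (y + 1) : ℝ) * s ^ (y + 1) + (Q.choose y : ℝ) * s ^ y

lemma eS_eq (Q y : ℕ) (s t : ℝ) (ht : (Q + 1) * t = 1 + Q * s) :
    eS Q s (y + 1) = ((Q + 1).choose (y + 1) : ℝ) * (s ^ (y + 1) - (y + 1) * s ^ y * (s - t)) := by
  have k1 : ((Q + 1).choose (y + 1) : ℝ) = Q.choose y + Q.choose (y + 1) := by
    rw [Nat.choose_succ_succ]; push_cast; ring
  have k2 : ((Q + 1).choose (y + 1) : ℝ) * (y + 1) = (Q + 1) * Q.choose y := by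
    have := Nat.add_one_mul_choose_eq Q y
    exact_mod_cast this.symm
  have e : s - t = (s - 1) / (Q + 1) := by
    field_simp
    linarith
  have hQ : ((Q : ℝ) + 1) ≠ 0 := by positivity
  have : ((Q + 1).choose (y + 1) : ℝ) * (s ^ (y + 1) - (y + 1) * s ^ y * (s - t))
      = ((Q + 1).choose (y + 1) : ℝ) * s ^ (y + 1)
        - (((Q + 1).choose (y + 1) : ℝ) * (y + 1)) * s ^ y * (s - t) := by ring
  rw [this, k2, k1, e]
  unfold eS
  field_simp
  ring

lemma eS_le (Q y : ℕ) (s t : ℝ) (hs : 0 < s) (ht0 : 0 < t) (ht : (Q + 1) * t = 1 + Q * s) :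
    eS Q s y ≤ ((Q + 1).choose y : ℝ) * t ^ y := by
  cases y with
  | zero => simp [eS]
  | succ y =>
    rw [eS_eq Q y s t ht]
    exact mul_le_mul_of_nonneg_left (bern s t hs ht0 y) (by positivity)

lemma eS_lt (Q y : ℕ) (s t : ℝ) (hs : 0 < s) (ht0 : 0 < t) (ht : (Q + 1) * t = 1 + Q * s)
    (hst : s ≠ t) (hy : 2 ≤ y) (hyQ : y ≤ Q + 1) :
    eS Q s y < ((Q + 1).choose y : ℝ) * t ^ y := by
  obtain ⟨j, rfl⟩ := Nat.exists_eq_add_of_le' hy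
  rw [eS_eq Q (j + 1) s t ht]
  have := bern_strict s t hs ht0 hst j
  have hc : (0 : ℝ) < ((Q + 1).choose (j + 2) : ℝ) := by exact_mod_cast Nat.choose_pos hyQ
  apply mul_lt_mul_of_pos_left _ hc
  push_cast
  have e : ((j : ℝ) + 1 + 1) = j + 2 := by ring
  rw [e]
  exact this

lemma nF_mul_pow (n x : ℕ) (hn : 0 < n) (c : ℝ) : nF n x * c ^ x = n.choose x * (c / n) ^ x := by
  unfold nF; rw [div_pow]; ring

/-- Equalising the second part (step B). -/
lemma stepB (n Q : ℕ) (hQ : 0 < Q) (h : Q + 1 ≤ n) (m : ℕ) (hm : 2 ≤ m) (hmn : m ≤ n + Q + 1) :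
    ∑ z ∈ Finset.HasAntidiagonal.antidiagonal m, (n.choose z.1 : ℝ) * eS Q ((n : ℝ) / Q) z.2 * (cw z.1 * cw z.2)
    < dG n (Q + 1) n (n + 1) m := by
  have hQ' : (0 : ℝ) < Q := by exact_mod_cast hQ
  have hn' : (0 : ℝ) < n := by exact_mod_cast (by omega : 0 < n)
  have hQn : (Q : ℝ) + 1 ≤ n := by exact_mod_cast h
  have e : dG n (Q + 1) n (n + 1) m = ∑ z ∈ Finset.HasAntidiagonal.antidiagonal m, (n.choose z.1 : ℝ) *
      (((Q + 1).choose z.2 : ℝ) * (((n : ℝ) + 1) / (Q + 1)) ^ z.2) * (cw z.1 * cw z.2) := by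
    unfold dG
    apply Finset.sum_congr rfl
    intro z _
    have e1 := nF_mul_pow n z.1 (by omega) n
    have e2 := nF_mul_pow (Q + 1) z.2 (by omega) (n + 1)
    rw [div_self hn'.ne', one_pow, mul_one] at e1
    push_cast at e2
    rw [← e1, ← e2]
    ring
  rw [e]
  have hs : 0 < (n : ℝ) / Q := by positivity
  have ht0 : 0 < ((n : ℝ) + 1) / (Q + 1) := by positivity
  have ht : ((Q : ℝ) + 1) * (((n : ℝ) + 1) / (Q + 1)) = 1 + Q * ((n : ℝ) / Q) := by
    field_simp
    ring
  have hst : (n : ℝ) / Q ≠ ((n : ℝ) + 1) / (Q + 1) := by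
    intro hh
    rw [div_eq_div_iff (by positivity) (by positivity)] at hh
    linarith
  apply Finset.sum_lt_sum
  · intro z _
    apply mul_le_mul_of_nonneg_right _ (mul_pos (cw_pos _) (cw_pos _)).le
    exact mul_le_mul_of_nonneg_left (eS_le Q z.2 _ _ hs ht0 ht) (by positivity)
  · refine ⟨(m - max 2 (m - n), max 2 (m - n)), ?_, ?_⟩
    · rw [Finset.HasAntidiagonal.mem_antidiagonal]
      simp only
      omega
    · apply mul_lt_mul_of_pos_right _ (mul_pos (cw_pos _) (cw_pos _))
      apply mul_lt_mul_of_pos_left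
      · exact eS_lt Q _ _ _ hs ht0 ht hst (by simp only; omega) (by simp only; omega)
      · exact_mod_cast Nat.choose_pos (by simp only; omega)

/-- The first comparison: moving the extra vertex (uses step A). -/
lemma stepA' (n Q : ℕ) (hQ : 0 < Q) (h : Q + 1 ≤ n) (k : ℕ) :
    dG (n + 1) Q (n + 1) n (k + 1) ≤
    ∑ z ∈ Finset.HasAntidiagonal.antidiagonal (k + 1),
      (n.choose z.1 : ℝ) * eS Q ((n : ℝ) / Q) z.2 * (cw z.1 * cw z.2) := by
  have hQ' : (0 : ℝ) < Q := by exact_mod_cast hQ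
  have hn' : (0 : ℝ) < n := by exact_mod_cast (by omega : 0 < n)
  have A := stepA n Q hQ (by omega) k
  have eA : ∀ f : ℕ → ℕ → ℝ, ∑ z ∈ Finset.HasAntidiagonal.antidiagonal k, nF n z.1 * nF Q z.2 * (n : ℝ) ^ k * f z.1 z.2
     = ∑ z ∈ Finset.HasAntidiagonal.antidiagonal k, (n.choose z.1 : ℝ) * (Q.choose z.2 * ((n : ℝ) / Q) ^ z.2) * f z.1 z.2 := by
    intro f
    apply Finset.sum_congr rfl
    intro z hz
    rw [Finset.HasAntidiagonal.mem_antidiagonal] at hz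
    rw [← hz, pow_add, ← nF_mul_pow Q z.2 hQ]
    have e1 := nF_mul_pow n z.1 (by omega) n
    rw [div_self hn'.ne', one_pow, mul_one] at e1
    rw [← e1]
    ring
  rw [eA (fun x y => cw (x + 1) * cw y), eA (fun x y => cw x * cw (y + 1))] at A
  have L : dG (n + 1) Q (n + 1) n (k + 1) = ∑ z ∈ Finset.HasAntidiagonal.antidiagonal (k + 1),
      (n.choose z.1 : ℝ) * (Q.choose z.2 * ((n : ℝ) / Q) ^ z.2) * (cw z.1 * cw z.2)
      + ∑ z ∈ Finset.HasAntidiagonal.antidiagonal k,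
      (n.choose z.1 : ℝ) * (Q.choose z.2 * ((n : ℝ) / Q) ^ z.2) * (cw (z.1 + 1) * cw z.2) := by
    have : dG (n + 1) Q (n + 1) n (k + 1) = ∑ z ∈ Finset.HasAntidiagonal.antidiagonal (k + 1),
      ((n + 1).choose z.1 : ℝ) * (Q.choose z.2 * ((n : ℝ) / Q) ^ z.2) * (cw z.1 * cw z.2) := by
      unfold dG
      apply Finset.sum_congr rfl
      intro z _
      have e1 := nF_mul_pow (n + 1) z.1 (by omega) (n + 1)
      push_cast at e1
      rw [div_self (by positivity), one_pow, mul_one] at e1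
      rw [← nF_mul_pow Q z.2 hQ, ← e1]
      ring
    rw [this, Finset.Nat.sum_antidiagonal_succ, Finset.Nat.sum_antidiagonal_succ, add_assoc,
      ← Finset.sum_add_distrib]
    congr 1
    · simp
    · apply Finset.sum_congr rfl
      intro z _
      simp only [Nat.choose_succ_succ' n]
      push_cast
      ring
  have R : ∑ z ∈ Finset.HasAntidiagonal.antidiagonal (k + 1),
      (n.choose z.1 : ℝ) * eS Q ((n : ℝ) / Q) z.2 * (cw z.1 * cw z.2)
      = ∑ z ∈ Finset.HasAntidiagonal.antidiagonal (k + 1),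
      (n.choose z.1 : ℝ) * (Q.choose z.2 * ((n : ℝ) / Q) ^ z.2) * (cw z.1 * cw z.2)
      + ∑ z ∈ Finset.HasAntidiagonal.antidiagonal k,
      (n.choose z.1 : ℝ) * (Q.choose z.2 * ((n : ℝ) / Q) ^ z.2) * (cw z.1 * cw (z.2 + 1)) := by
    rw [Finset.Nat.sum_antidiagonal_succ', Finset.Nat.sum_antidiagonal_succ', add_assoc,
      ← Finset.sum_add_distrib]
    congr 1
    · simp [eS]
    · apply Finset.sum_congr rfl
      intro z _
      simp only [eS]
      ring
  rw [L, R]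
  linarith

/-- The critical case. -/
lemma critical (n Q : ℕ) (hQ : 0 < Q) (h : Q + 1 ≤ n) (m : ℕ) (hm : 2 ≤ m) (hmn : m ≤ n + Q + 1) :
    dG (n + 1) Q (n + 1) n m < dG n (Q + 1) (n + 1) n m := by
  have h1 : dG (n + 1) Q (n + 1) n m ≤ ∑ z ∈ Finset.HasAntidiagonal.antidiagonal m,
      (n.choose z.1 : ℝ) * eS Q ((n : ℝ) / Q) z.2 * (cw z.1 * cw z.2) := by
    obtain ⟨k, rfl⟩ := Nat.exists_eq_add_of_le' (by omega : 1 ≤ m)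
    exact stepA' n Q hQ h k
  exact h1.trans_lt ((stepB n Q hQ h m hm hmn).trans_le (stepC n (Q + 1) (by omega) h m))

/-- Tilting a sum whose coefficients change sign once. -/
lemma tilt (m : ℕ) (K r : ℕ → ℝ) (hK : ∀ x, 0 ≤ K x) (hr : Antitone r) (α β : ℝ)
    (hα : 0 < α) (hαβ : α ≤ β) (hpos : 0 < ∑ x ∈ Finset.range (m + 1), K x * r x) :
    0 < ∑ x ∈ Finset.range (m + 1), K x * r x * (α ^ x * β ^ (m - x)) := by
  have hβ : 0 < β := hα.trans_le hαβ
  have mono : ∀ x z, x ≤ z → z ≤ m → α ^ z * β ^ (m - z) ≤ α ^ x * β ^ (m - x) := by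
    intro x z hxz hz
    obtain ⟨d, rfl⟩ := Nat.exists_eq_add_of_le hxz
    have : m - x = d + (m - (x + d)) := by omega
    rw [this, pow_add, pow_add, mul_assoc]
    gcongr
  obtain ⟨x0, hx0, hle, hgt⟩ : ∃ x0, x0 ≤ m ∧ (∀ x, x ≤ x0 → 0 ≤ r x) ∧
      (∀ x, x0 < x → x ≤ m → r x ≤ 0) := by
    by_contra hcon
    push Not at hcon
    have hall : ∀ z, z ≤ m → 0 ≤ r z := by
      intro z
      induction z with
      | zero =>
        intro _
        by_contra h0
        push Not at h0
        apply absurd hpos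
        push Not
        apply Finset.sum_nonpos
        intro x _
        exact mul_nonpos_of_nonneg_of_nonpos (hK x) ((hr (Nat.zero_le x)).trans h0.le)
      | succ z ih =>
        intro hz
        have hz0 := ih (by omega)
        obtain ⟨x, hx1, hx2, hx3⟩ := hcon z (by omega) (fun x hx => hz0.trans (hr hx))
        exact hx3.le.trans (hr hx1)
    obtain ⟨x, hx1, hx2, _⟩ := hcon m le_rfl (fun x hx => hall x hx)
    omega
  have hc : 0 < α ^ x0 * β ^ (m - x0) := by positivity
  have h1 : (∑ x ∈ Finset.range (m + 1), K x * r x) * (α ^ x0 * β ^ (m - x0)) ≤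
      ∑ x ∈ Finset.range (m + 1), K x * r x * (α ^ x * β ^ (m - x)) := by
    rw [Finset.sum_mul]
    apply Finset.sum_le_sum
    intro x hx
    have hxm : x ≤ m := by have := Finset.mem_range.1 hx; omega
    rcases le_or_gt x x0 with hh | hh
    · exact mul_le_mul_of_nonneg_left (mono x x0 hh hx0) (mul_nonneg (hK x) (hle x hh))
    · exact mul_le_mul_of_nonpos_left (mono x0 x hh.le hxm)
        (mul_nonpos_of_nonneg_of_nonpos (hK x) (hgt x hh hxm))
  exact (mul_pos hpos hc).trans_le h1

lemma dG_diff (n Q : ℕ) (hQ : 0 < Q) (hn : 0 < n) (a b α β : ℝ) (m : ℕ) :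
    dG n (Q + 1) (α * a) (β * b) m - dG (n + 1) Q (α * a) (β * b) m =
    ∑ x ∈ Finset.range (m + 1), (nF (n + 1) x * nF (Q + 1) (m - x) * (a ^ x * b ^ (m - x)) *
      (cw x * cw (m - x))) * (gR n x - gR Q (m - x)) * (α ^ x * β ^ (m - x)) := by
  unfold dG
  rw [← Finset.sum_sub_distrib, ← Finset.Nat.sum_antidiagonal_eq_sum_range_succ
    (fun x y => (nF (n + 1) x * nF (Q + 1) y * (a ^ x * b ^ y) *
      (cw x * cw y)) * (gR n x - gR Q y) * (α ^ x * β ^ y)) m]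
  apply Finset.sum_congr rfl
  intro z _
  rw [nF_gR n _ hn, nF_gR Q _ hQ, mul_pow, mul_pow]
  ring

lemma dG_lt (n Q : ℕ) (hQ : 0 < Q) (h : Q + 1 ≤ n) (m : ℕ) (hm : 2 ≤ m) (hmn : m ≤ n + Q + 1)
    (a b : ℝ) (ha : 0 < a) (hab : a * n ≤ b * (n + 1)) :
    dG (n + 1) Q a b m < dG n (Q + 1) a b m := by
  have hn0 : 0 < n := by omega
  have hn' : (0 : ℝ) < n := by exact_mod_cast hn0
  have hc := sub_pos.2 (critical n Q hQ h m hm hmn)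
  have e1 := dG_diff n Q hQ hn0 (n + 1) n 1 1 m
  simp only [one_mul, one_pow, mul_one] at e1
  rw [e1] at hc
  have hr : Antitone (fun x => gR n x - gR Q (m - x)) := by
    intro x z hxz
    have h1 := gR_anti n hn0 hxz
    have h2 := gR_anti Q hQ (by omega : m - z ≤ m - x)
    simp only
    linarith
  have ht := tilt m (fun x => nF (n + 1) x * nF (Q + 1) (m - x) *
      (((n : ℝ) + 1) ^ x * (n : ℝ) ^ (m - x)) * (cw x * cw (m - x))) _ (by
        intro x
        have := nF_nonneg (n + 1) x
        have := nF_nonneg (Q + 1) (m - x)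
        have := cw_pos x
        have := cw_pos (m - x)
        positivity) hr (a / (n + 1)) (b / n) (by positivity)
        (by rw [div_le_div_iff₀ (by positivity) hn']; exact hab) hc
  rw [← dG_diff n Q hQ hn0, div_mul_cancel₀ _ (by positivity), div_mul_cancel₀ _ hn'.ne'] at ht
  linarith

theorem balancing_parts_improves_density (P Q : ℕ) (hQ : 0 < Q) (hPQ : Q + 2 ≤ P)
    (p q : ℝ) (hp : p ∈ Set.Ioo (0:ℝ) 1) (hq : q ∈ Set.Ioo (0:ℝ) 1)
    (hsum : (P : ℝ) * p + (Q : ℝ) * q = 1)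
    (hle : ((P : ℝ) - 1) * p ≤ (Q : ℝ) * q) :
    (P : ℝ) * p / ((P : ℝ) - 1) ∈ Set.Ioo (0:ℝ) 1 ∧
    (Q : ℝ) * q / ((Q : ℝ) + 1) ∈ Set.Ioo (0:ℝ) 1 ∧
    ((P : ℝ) - 1) * ((P : ℝ) * p / ((P : ℝ) - 1))
      + ((Q : ℝ) + 1) * ((Q : ℝ) * q / ((Q : ℝ) + 1)) = 1 ∧
    ∀ m : ℕ, 2 ≤ m → m ≤ P + Q →
      dRpq m P Q p q
        < dRpq m (P - 1) (Q + 1) ((P : ℝ) * p / ((P : ℝ) - 1)) ((Q : ℝ) * q / ((Q : ℝ) + 1)) := by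
  obtain ⟨n, rfl⟩ := Nat.exists_eq_add_of_le' (by omega : 1 ≤ P)
  have hn : Q + 1 ≤ n := by omega
  have hQ' : (0 : ℝ) < Q := by exact_mod_cast hQ
  have hQ1 : (1 : ℝ) ≤ Q := by exact_mod_cast hQ
  have hn' : (Q : ℝ) + 1 ≤ n := by exact_mod_cast hn
  have hn0 : (0 : ℝ) < n := by linarith
  have en : ((n + 1 : ℕ) : ℝ) - 1 = n := by push_cast; ring
  rw [en] at hle ⊢
  obtain ⟨hp0, hp1⟩ := hp
  obtain ⟨hq0, hq1⟩ := hq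
  have ha : 0 < ((n + 1 : ℕ) : ℝ) * p := by positivity
  have hb : 0 < (Q : ℝ) * q := by positivity
  refine ⟨⟨by positivity, ?_⟩, ⟨by positivity, ?_⟩, ?_, ?_⟩
  · rw [div_lt_one hn0]; linarith
  · rw [div_lt_one (by linarith)]; linarith
  · rw [mul_div_cancel₀ _ hn0.ne', mul_div_cancel₀ _ (by positivity)]
    exact hsum
  · intro m hm hmP
    rw [dRpq_eq m (n + 1) Q (by omega) hQ, dRpq_eq m (n + 1 - 1) (Q + 1) (by omega) (by omega)]
    have hf : (0 : ℝ) < m.factorial := by exact_mod_cast m.factorial_pos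
    apply mul_lt_mul_of_pos_left _ hf
    have e1 : ((n + 1 - 1 : ℕ) : ℝ) * (((n + 1 : ℕ) : ℝ) * p / n) = ((n + 1 : ℕ) : ℝ) * p := by
      rw [Nat.add_sub_cancel, mul_div_cancel₀ _ hn0.ne']
    have e2 : ((Q + 1 : ℕ) : ℝ) * ((Q : ℝ) * q / (Q + 1)) = (Q : ℝ) * q := by
      push_cast
      rw [mul_div_cancel₀ _ (by positivity)]
    rw [e1, e2, Nat.add_sub_cancel]
    apply dG_lt n Q hQ hn m hm (by omega) _ _ ha
    push_cast
    have := mul_le_mul_of_nonneg_left hle (by positivity : (0 : ℝ) ≤ (n : ℝ) + 1)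
    linarith
end

section
/- Let P,Q be positive integers with P ≥ Q+2 and let p,q ∈ (0,1) be real numbers with Pp + Qq = 1 and (P−1)p ≤ Qq. Set P' = P−1, Q' = Q+1, p' = Pp/(P−1), and q' = Qq/(Q+1). Then for every integer m with 2 ≤ m ≤ P+Q and every integer r with 0 ≤ r ≤ ⌊m/2⌋, one has N_{m,r}(p,P;q,Q) ≤ N_{m,r}(p',P';q',Q'). -/
/-- `N_{m,r}(p,P;q,Q) = ∑_{x+y=m, x,y ≥ r} C(P,x) p^x C(Q,y) q^y · x!y!/((x−r)!(y−r)!)`. -/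
noncomputable def Nmr (m r P Q : ℕ) (p q : ℝ) : ℝ :=
  ∑ x ∈ Finset.Icc r (m - r),
    (P.choose x : ℝ) * p ^ x * (Q.choose (m - x) : ℝ) * q ^ (m - x) *
      ((x.factorial : ℝ) * ((m - x).factorial : ℝ) /
        (((x - r).factorial : ℝ) * ((m - x - r).factorial : ℝ)))

open Polynomial in
lemma aux_coeff (a : ℝ) (n k : ℕ) :
    ((1 + C a * X : ℝ[X]) ^ n).coeff k = (n.choose k : ℝ) * a ^ k := by
  have h : (1 + C a * X : ℝ[X]) ^ n = ((1 + X : ℝ[X]) ^ n).comp (C a * X) := by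
    simp
  rw [h, comp_C_mul_X_coeff, coeff_one_add_X_pow]

/-- Coefficientwise order on polynomials. -/
def CoefLe (f g : Polynomial ℝ) : Prop := ∀ k, f.coeff k ≤ g.coeff k

lemma CoefLe.trans' {f g h : Polynomial ℝ} (h1 : CoefLe f g) (h2 : CoefLe g h) : CoefLe f h :=
  fun k => (h1 k).trans (h2 k)

lemma CoefLe.mul_left' {f g h : Polynomial ℝ} (h0 : CoefLe 0 h) (h1 : CoefLe f g) :
    CoefLe (h * f) (h * g) := by
  intro k
  rw [Polynomial.coeff_mul, Polynomial.coeff_mul]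
  refine Finset.sum_le_sum fun x _ => mul_le_mul_of_nonneg_left (h1 _) ?_
  simpa using h0 x.1

lemma CoefLe.mul_nonneg' {f g : Polynomial ℝ} (h0 : CoefLe 0 f) (h1 : CoefLe 0 g) :
    CoefLe 0 (f * g) := by
  simpa using CoefLe.mul_left' h0 h1

open Polynomial in
lemma pow_nonneg_coef {a : ℝ} (ha : 0 ≤ a) (n : ℕ) : CoefLe 0 ((1 + C a * X : ℝ[X]) ^ n) := by
  intro k
  rw [aux_coeff]
  simp only [coeff_zero]
  positivity

open Polynomial in
lemma lin_nonneg_coef {a : ℝ} (ha : 0 ≤ a) : CoefLe 0 (1 + C a * X : ℝ[X]) := by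
  simpa using pow_nonneg_coef ha 1

open Polynomial in
lemma lin_le {a b : ℝ} (h : a ≤ b) : CoefLe (1 + C a * X : ℝ[X]) (1 + C b * X) := by
  intro k
  simp only [coeff_add, coeff_C_mul, coeff_X]
  split_ifs <;> simp [h]

open Polynomial in
lemma quad_le {a b c d : ℝ} (h : a + b = c + d) (h2 : a * b ≤ c * d) :
    CoefLe ((1 + C a * X) * (1 + C b * X) : ℝ[X]) ((1 + C c * X) * (1 + C d * X)) := by
  have e : ∀ x y : ℝ, ((1 + C x * X) * (1 + C y * X) : ℝ[X])
      = 1 + C (x + y) * X + C (x * y) * X ^ 2 := by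
    intro x y; simp only [C_add, C_mul]; ring
  rw [e, e, h]
  intro k
  simp only [coeff_add, coeff_C_mul, coeff_X_pow]
  split_ifs <;> simp [h2]

open Polynomial in
lemma main_list (p q : ℝ) (hp : 0 ≤ p) (hpq : p ≤ q) : ∀ (l : List ℝ) (A B : ℕ) (c : ℝ),
    (∀ t ∈ l, p ≤ t ∧ t ≤ q) → p ≤ c → c ≤ q → l.length = A + B + 1 →
    A * p + B * q + c ≤ l.sum →
    CoefLe ((1 + C p * X) ^ A * (1 + C q * X) ^ B * (1 + C c * X) : ℝ[X])
      (l.map fun t => (1 + C t * X : ℝ[X])).prod := by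
  intro l
  induction l with
  | nil => intro A B c _ _ _ h; simp at h
  | cons t l ih =>
    intro A B c hl hc1 hc2 hlen hs
    have ht := hl t (by simp)
    have hl' : ∀ t ∈ l, p ≤ t ∧ t ≤ q := fun u hu => hl u (by simp [hu])
    have hlow : (l.length : ℝ) * p ≤ l.sum := by
      have := List.card_nsmul_le_sum l p (fun x hx => (hl' x hx).1)
      simpa using this
    have hup : l.sum ≤ (l.length : ℝ) * q := by
      have := List.sum_le_card_nsmul l q (fun x hx => (hl' x hx).2)
      simpa using this
    have hq : 0 ≤ q := hp.trans hpq
    have ht0 : 0 ≤ t := hp.trans ht.1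
    simp only [List.length_cons, List.sum_cons, List.map_cons, List.prod_cons] at hlen hs ⊢
    have hlen' : l.length = A + B := by omega
    rw [hlen'] at hlow hup
    push_cast at hlow hup
    rcases le_or_gt c t with h | h
    · rcases B with _ | B
      · rcases A with _ | A
        · have : l = [] := by simpa using hlen'
          subst this
          simpa using lin_le h
        · have h1 := ih A 0 p hl' le_rfl hpq (by omega) (by push_cast at hlow ⊢; linarith)
          have h2 := CoefLe.mul_left' (lin_nonneg_coef ht0) h1
          have h3 := CoefLe.mul_left' (pow_nonneg_coef hp (A+1)) (lin_le h)
          refine CoefLe.trans' ?_ h2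
          convert h3 using 1 <;> ring
      · have h1 := ih A B (c + q - t) hl' (by linarith) (by linarith) (by omega)
          (by push_cast at hs ⊢; linarith)
        have h2 := CoefLe.mul_left' (lin_nonneg_coef ht0) h1
        have h3 := CoefLe.mul_left' (CoefLe.mul_nonneg' (pow_nonneg_coef hp A) (pow_nonneg_coef hq B))
          (quad_le (a := c) (b := q) (c := t) (d := c + q - t) (by ring) (by nlinarith))
        refine CoefLe.trans' ?_ h2
        convert h3 using 1 <;> ring
    · rcases A with _ | A
      · exfalso
        push_cast at hs hup
        linarith
      · have h1 := ih A B (c + p - t) hl' (by linarith) (by linarith) (by omega)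
          (by push_cast at hs ⊢; linarith)
        have h2 := CoefLe.mul_left' (lin_nonneg_coef ht0) h1
        have h3 := CoefLe.mul_left' (CoefLe.mul_nonneg' (pow_nonneg_coef hp A) (pow_nonneg_coef hq B))
          (quad_le (a := c) (b := p) (c := t) (d := c + p - t) (by ring) (by nlinarith))
        refine CoefLe.trans' ?_ h2
        convert h3 using 1 <;> ring

lemma choose_fact (P r k : ℕ) :
    (P.choose (r + k) : ℝ) * ((r + k).factorial : ℝ) / (k.factorial : ℝ)
      = (P.descFactorial r : ℝ) * ((P - r).choose k : ℝ) := by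
  have hk : (k.factorial : ℝ) ≠ 0 := by positivity
  rw [div_eq_iff hk]
  have h1 : P.choose (r + k) * (r + k).factorial = P.descFactorial (r + k) := by
    rw [Nat.descFactorial_eq_factorial_mul_choose, mul_comm]
  have h2 : (P - r).choose k * k.factorial = (P - r).descFactorial k := by
    rw [Nat.descFactorial_eq_factorial_mul_choose, mul_comm]
  have h3 : P.descFactorial (r + k) = P.descFactorial r * (P - r).descFactorial k := by
    induction k with
    | zero => simp
    | succ k ih =>
      have := ih (by positivity) (by rw [Nat.descFactorial_eq_factorial_mul_choose, mul_comm])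
        (by rw [Nat.descFactorial_eq_factorial_mul_choose, mul_comm])
      rw [← add_assoc, Nat.descFactorial_succ, Nat.descFactorial_succ, this, Nat.sub_sub]
      ring
  rw [mul_assoc]
  exact_mod_cast (h1.trans (h3.trans (by rw [h2])))

open Polynomial in
lemma Nmr_eq (n r P Q : ℕ) (p q : ℝ) :
    Nmr (n + 2 * r) r P Q p q = ((P.descFactorial r : ℝ) * (Q.descFactorial r) * (p ^ r * q ^ r)) *
      ((1 + C p * X : ℝ[X]) ^ (P - r) * (1 + C q * X) ^ (Q - r)).coeff n := by
  rw [coeff_mul, Finset.Nat.sum_antidiagonal_eq_sum_range_succ_mk, Finset.mul_sum, Nmr]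
  have : Finset.Icc r (n + 2 * r - r) = Finset.Ico r (n + 1 + r) := by
    ext x; simp only [Finset.mem_Icc, Finset.mem_Ico]; omega
  rw [this, Finset.sum_Ico_eq_sum_range]
  have h' : n + 1 + r - r = n.succ := by omega
  rw [h']
  refine Finset.sum_congr rfl fun k hk => ?_
  have hk' : k ≤ n := by simpa [Nat.lt_succ_iff] using hk
  obtain ⟨j, rfl⟩ := Nat.exists_eq_add_of_le hk'
  have e1 : k + j + 2 * r - (r + k) = r + j := by omega
  have e2 : r + k - r = k := by omega
  have e3 : r + j - r = j := by omega
  have e4 : k + j - k = j := by omega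
  simp only [e1, e2, e3, e4, aux_coeff]
  have a1 := choose_fact P r k
  have a2 := choose_fact Q r j
  calc _ = ((P.choose (r + k) : ℝ) * ((r + k).factorial : ℝ) / (k.factorial : ℝ)) *
        ((Q.choose (r + j) : ℝ) * ((r + j).factorial : ℝ) / (j.factorial : ℝ)) *
          (p ^ (r + k) * q ^ (r + j)) := by
        field_simp
    _ = _ := by rw [a1, a2, pow_add, pow_add]; ring

lemma Nmr_nonneg (m r P Q : ℕ) {p q : ℝ} (hp : 0 ≤ p) (hq : 0 ≤ q) : 0 ≤ Nmr m r P Q p q := by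
  unfold Nmr
  refine Finset.sum_nonneg fun x _ => ?_
  positivity

lemma factor_le (P Q : ℕ) (hQ : 0 < Q) (hPQ : Q + 2 ≤ P) (p q : ℝ) (hp : 0 ≤ p) (hq : 0 ≤ q)
    (r : ℕ) (hr : r ≤ Q) :
    (P.descFactorial r : ℝ) * (Q.descFactorial r) * (p ^ r * q ^ r) ≤
    ((P-1).descFactorial r : ℝ) * ((Q+1).descFactorial r) *
      (((P : ℝ) * p / ((P : ℝ) - 1)) ^ r * ((Q : ℝ) * q / ((Q : ℝ) + 1)) ^ r) := by
  have hPQ' : (Q : ℝ) + 2 ≤ P := by exact_mod_cast hPQ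
  have hQ' : (0 : ℝ) < Q := by exact_mod_cast hQ
  have hP1 : (0 : ℝ) < (P : ℝ) - 1 := by linarith
  induction r with
  | zero => simp
  | succ i ih =>
    have ih := ih (by omega)
    have hi : (i : ℝ) + 1 ≤ Q := by exact_mod_cast hr
    have hi0 : (0 : ℝ) ≤ i := by positivity
    simp only [Nat.descFactorial_succ, Nat.cast_mul, pow_succ]
    rw [Nat.cast_sub (by omega : i ≤ P), Nat.cast_sub (by omega : i ≤ Q),
      Nat.cast_sub (by omega : i ≤ P - 1), Nat.cast_sub (by omega : i ≤ Q + 1),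
      Nat.cast_sub (by omega : 1 ≤ P)]
    push_cast
    have step : ((P : ℝ) - i) * (Q - i) * (p * q) ≤ ((P : ℝ) - 1 - i) * (Q + 1 - i) *
        (((P : ℝ) * p / ((P : ℝ) - 1)) * ((Q : ℝ) * q / ((Q : ℝ) + 1))) := by
      have e : ((P : ℝ) - 1 - i) * (Q + 1 - i) *
        (((P : ℝ) * p / ((P : ℝ) - 1)) * ((Q : ℝ) * q / ((Q : ℝ) + 1)))
         = (((P : ℝ) - 1 - i) * (Q + 1 - i) * (P * Q) / ((P - 1) * (Q + 1))) * (p * q) := by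
        field_simp
      rw [e]
      refine mul_le_mul_of_nonneg_right ?_ (by positivity)
      rw [le_div_iff₀ (by positivity)]
      have k1 : 0 ≤ (i : ℝ) * (P + Q - i) := mul_nonneg hi0 (by linarith)
      have k2 : 0 ≤ (i : ℝ) * (P + Q - i) * (P - Q - 1) := mul_nonneg k1 (by linarith)
      nlinarith
    have := mul_le_mul ih step (by
      have : 0 ≤ (P : ℝ) - i := by linarith
      have : 0 ≤ (Q : ℝ) - i := by linarith
      positivity) (by positivity)
    refine le_trans (le_of_eq ?_) (this.trans (le_of_eq ?_))
    · ring
    · generalize (P : ℝ) * p / ((P : ℝ) - 1) = p' at *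
      generalize (Q : ℝ) * q / ((Q : ℝ) + 1) = q' at *
      ring

theorem Nmr_le_of_balancing (P Q : ℕ) (hQ : 0 < Q) (hPQ : Q + 2 ≤ P)
    (p q : ℝ) (hp : p ∈ Set.Ioo (0:ℝ) 1) (hq : q ∈ Set.Ioo (0:ℝ) 1)
    (hsum : (P : ℝ) * p + (Q : ℝ) * q = 1)
    (hle : ((P : ℝ) - 1) * p ≤ (Q : ℝ) * q) :
    ∀ m r : ℕ, 2 ≤ m → m ≤ P + Q → r ≤ m / 2 →
      Nmr m r P Q p q
        ≤ Nmr m r (P - 1) (Q + 1) ((P : ℝ) * p / ((P : ℝ) - 1)) ((Q : ℝ) * q / ((Q : ℝ) + 1)) := by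
  intro m r _ _ hrm
  obtain ⟨n, rfl⟩ : ∃ n, m = n + 2 * r := ⟨m - 2 * r, by omega⟩
  have hp0 := hp.1
  have hq0 := hq.1
  have hPQ' : (Q : ℝ) + 2 ≤ P := by exact_mod_cast hPQ
  have hQ' : (0 : ℝ) < Q := by exact_mod_cast hQ
  have hP1 : (0 : ℝ) < (P : ℝ) - 1 := by linarith
  have hp'0 : 0 ≤ (P : ℝ) * p / ((P : ℝ) - 1) := by positivity
  have hq'0 : 0 ≤ (Q : ℝ) * q / ((Q : ℝ) + 1) := by positivity
  rcases lt_or_ge Q r with hr | hr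
  · rw [Nmr_eq, Nat.descFactorial_of_lt hr]
    simpa using Nmr_nonneg (n + 2 * r) r (P-1) (Q+1) hp'0 hq'0
  rw [Nmr_eq, Nmr_eq]
  have hF := factor_le P Q hQ hPQ p q hp0.le hq0.le r hr
  have hpq : p ≤ q := by
    by_contra! h
    nlinarith
  have b1 : p ≤ (P : ℝ) * p / ((P : ℝ) - 1) := by rw [le_div_iff₀ hP1]; nlinarith
  have b2 : (P : ℝ) * p / ((P : ℝ) - 1) ≤ q := by
    rw [div_le_iff₀ hP1]
    have h1 : (P - 1) * p ≤ (P - 2) * q := hle.trans (by nlinarith)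
    nlinarith
  have b3 : p ≤ (Q : ℝ) * q / ((Q : ℝ) + 1) := by
    rw [le_div_iff₀ (by positivity)]; nlinarith
  have b4 : (Q : ℝ) * q / ((Q : ℝ) + 1) ≤ q := by
    rw [div_le_iff₀ (by positivity)]; nlinarith
  have b5 : (P : ℝ) * p / ((P : ℝ) - 1) + (Q : ℝ) * q / ((Q : ℝ) + 1) ≤ p + q := by
    have e1 : (P : ℝ) * p / ((P : ℝ) - 1) = p + p / (P - 1) := by field_simp; ring
    have e2 : (Q : ℝ) * q / ((Q : ℝ) + 1) = q - q / (Q + 1) := by field_simp; ring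
    have : p / (P - 1) ≤ q / ((Q : ℝ) + 1) :=
      div_le_div₀ hq0.le hpq (by positivity) (by linarith)
    rw [e1, e2]; linarith
  have hPp : ((P : ℝ) - 1) * ((P : ℝ) * p / ((P : ℝ) - 1)) = P * p := by field_simp
  have hQq : ((Q : ℝ) + 1) * ((Q : ℝ) * q / ((Q : ℝ) + 1)) = Q * q := by field_simp
  generalize (P : ℝ) * p / ((P : ℝ) - 1) = p' at *
  generalize (Q : ℝ) * q / ((Q : ℝ) + 1) = q' at *
  have hr0 : (0 : ℝ) ≤ r := by positivity
  have key := main_list p q hp0.le hpq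
    (List.replicate (P - 1 - r) p' ++ List.replicate (Q + 1 - r) q') (P - 1 - r) (Q - r) p
    (by
      intro t ht
      simp only [List.mem_append, List.mem_replicate] at ht
      rcases ht with ⟨_, rfl⟩ | ⟨_, rfl⟩ <;> constructor <;> assumption)
    le_rfl hpq (by simp; omega)
    (by
      simp only [List.sum_append, List.sum_replicate, nsmul_eq_mul]
      rw [Nat.cast_sub (by omega : r ≤ P - 1), Nat.cast_sub (by omega : r ≤ Q),
        Nat.cast_sub (by omega : r ≤ Q + 1), Nat.cast_sub (by omega : 1 ≤ P)]
      push_cast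
      nlinarith [mul_le_mul_of_nonneg_left b5 hr0]) n
  simp only [List.map_append, List.map_replicate, List.prod_append, List.prod_replicate] at key
  have eP : P - r = (P - 1 - r) + 1 := by omega
  refine mul_le_mul hF ?_ ?_ (by positivity)
  · refine le_trans (le_of_eq ?_) key
    rw [eP]
    congr 1
    ring
  · simpa using CoefLe.mul_nonneg' (pow_nonneg_coef hp0.le (P - r)) (pow_nonneg_coef hq0.le (Q - r)) n
end
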